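/- arXiv:1207.5042 — 7 statements merged into one kernel-verified Lean document; each statement's English description precedes it below -/
import Mathlib

section
/- Let g ≥ 1 and k ≥ 0, and let α_1,…,α_k and β_1,…,β_k be nonzero integers. Then the abelian group N(g,k,α,β) contains an element of order 2; that is, there exists a ∈ N(g,k,α,β) with a ≠ 0 and 2·a = 0. (This is Lemma 3.1 of the paper: the first homology of a closed orientable Seifert fibered space (−g | α_1/β_1, …, α_k/β_k) over a nonorientable base has 2-torsion.) -/
/-- The free abelian group on generators `x_1,…,x_g, μ_1,…,μ_k, t`. -/
abbrev NFree (g k : ℕ) : Type := (Fin g ⊕ Fin k ⊕ Unit) →₀ ℤ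

/-- The generator `x_i`. -/
noncomputable def Nx (g k : ℕ) (i : Fin g) : NFree g k := Finsupp.single (Sum.inl i) 1

/-- The generator `μ_j`. -/
noncomputable def Nmu (g k : ℕ) (j : Fin k) : NFree g k := Finsupp.single (Sum.inr (Sum.inl j)) 1

/-- The generator `t`. -/
noncomputable def Nt (g k : ℕ) : NFree g k := Finsupp.single (Sum.inr (Sum.inr ())) 1

/-- The subgroup generated by the relations `α_j μ_j + β_j t`, `2 t`,
and `2(x_1 + ⋯ + x_g) + μ_1 + ⋯ + μ_k`. -/
noncomputable def NRels (g k : ℕ) (α β : Fin k → ℤ) : AddSubgroup (NFree g k) :=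
  AddSubgroup.closure
    ((Set.range fun j : Fin k => α j • Nmu g k j + β j • Nt g k) ∪
      {(2 : ℤ) • Nt g k} ∪
      {(2 : ℤ) • (∑ i : Fin g, Nx g k i) + ∑ j : Fin k, Nmu g k j})

/-- The abelian group `N(g,k,α,β)`, the first homology of the Seifert fibered
space `(−g | α_1/β_1, …, α_k/β_k)` over a nonorientable base. -/
abbrev NGroup (g k : ℕ) (α β : Fin k → ℤ) : Type := NFree g k ⧸ NRels g k α β

/-- In a group without elements of order two, an element killed by a nonzero integer is killed by
an odd integer. -/
theorem exists_odd_zsmul_eq_zero {A : Type*} [AddCommGroup A]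
    (h : ∀ a : A, (2 : ℤ) • a = 0 → a = 0) {n : ℤ} (hn : n ≠ 0) {a : A} (ha : n • a = 0) :
    ∃ m : ℤ, Odd m ∧ m • a = 0 := by
  have cancel : ∀ (e : ℕ) (b : A), (2 ^ e : ℤ) • b = 0 → b = 0 := by
    intro e
    induction e with
    | zero => intro b hb; simpa using hb
    | succ e ih =>
      intro b hb
      rw [pow_succ, mul_smul] at hb
      exact h b (ih _ hb)
  obtain ⟨m, hm, hdvd⟩ :=
    (Int.finiteMultiplicity_iff (a := 2).2 ⟨by decide, hn⟩).exists_eq_pow_mul_and_not_dvd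
  refine ⟨m, Int.not_even_iff_odd.1 fun hev => hdvd hev.two_dvd, ?_⟩
  rw [hm, mul_smul] at ha
  exact cancel _ _ ha

/-- The relations lie in the kernel of the mod two reduction of each coordinate `x_i`. -/
theorem intCast_apply_inl_eq_zero_of_mem_NRels {g k : ℕ} {α β : Fin k → ℤ} (i : Fin g)
    {v : NFree g k} (hv : v ∈ NRels g k α β) : ((v (Sum.inl i) : ℤ) : ZMod 2) = 0 := by
  have hle : NRels g k α β ≤
      ((Int.castAddHom (ZMod 2)).comp (Finsupp.applyAddHom (Sum.inl i))).ker := by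
    refine (AddSubgroup.closure_le _).2 ?_
    have h2 : (2 : ZMod 2) = 0 := rfl
    rintro w ((⟨j, rfl⟩ | rfl) | rfl) <;>
      simp [AddMonoidHom.mem_ker, Nmu, Nt, Nx, h2]
  exact hle hv

/-- Lemma 3.1: `H_1` of a Seifert fibered space over a nonorientable base has
an element of order 2. -/
theorem ngroup_has_two_torsion (g k : ℕ) (hg : 1 ≤ g) (α β : Fin k → ℤ)
    (hα : ∀ j, α j ≠ 0) (hβ : ∀ j, β j ≠ 0) :
    ∃ a : NGroup g k α β, a ≠ 0 ∧ (2 : ℤ) • a = 0 := by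
  by_contra! hno
  have h2 : ∀ a : NGroup g k α β, (2 : ℤ) • a = 0 → a = 0 := fun a ha =>
    by_contra fun hne => hno a hne ha
  let q : NFree g k →+ NGroup g k α β := QuotientAddGroup.mk' (NRels g k α β)
  have hq : ∀ v ∈ NRels g k α β, q v = 0 := fun v hv => (QuotientAddGroup.eq_zero_iff v).2 hv
  have ht : q (Nt g k) = 0 := by
    apply h2
    rw [← map_zsmul]
    exact hq _ (AddSubgroup.subset_closure (Or.inl (Or.inr rfl)))
  have hμ : ∀ j, ∃ m : ℤ, Odd m ∧ m • q (Nmu g k j) = 0 := by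
    intro j
    refine exists_odd_zsmul_eq_zero h2 (hα j) ?_
    have h := hq _ (AddSubgroup.subset_closure (Or.inl (Or.inl ⟨j, rfl⟩)))
    simpa only [map_add, map_zsmul, ht, smul_zero, add_zero] using h
  choose m hm hmμ using hμ
  have hM : Odd (∏ j, m j) := Finset.prod_induction m Odd (fun _ _ => Odd.mul) odd_one
    fun j _ => hm j
  have hMμ : (∏ j, m j) • q (∑ j, Nmu g k j) = 0 := by
    rw [map_sum, Finset.smul_sum]
    refine Finset.sum_eq_zero fun j _ => ?_
    obtain ⟨c, hc⟩ := Finset.dvd_prod_of_mem m (Finset.mem_univ j)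
    rw [hc, mul_comm, mul_smul, hmμ, smul_zero]
  have hx : q ((∏ j, m j) • ∑ i, Nx g k i) = 0 := by
    apply h2
    have h := hq _ (AddSubgroup.subset_closure (Or.inr rfl))
    rw [map_add, map_zsmul] at h
    rw [map_zsmul, smul_comm, eq_neg_of_add_eq_zero_left h, zsmul_neg, hMμ, neg_zero]
  have h0 := intCast_apply_inl_eq_zero_of_mem_NRels ⟨0, hg⟩ ((QuotientAddGroup.eq_zero_iff _).1 hx)
  have hval : ((∏ j, m j) • ∑ i, Nx g k i) (Sum.inl ⟨0, hg⟩) = ∏ j, m j := by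
    simp [Nx, Finsupp.single_apply]
  rw [hval, ZMod.intCast_zmod_eq_zero_iff_dvd] at h0
  exact Int.not_even_iff_odd.2 hM (even_iff_two_dvd.2 h0)
end

section
/- Let g ≥ 1 and k ≥ 0, and let α_1,…,α_k and β_1,…,β_k be nonzero integers. Let π be the group presented with generators x_1,…,x_g, μ_1,…,μ_k, t and relators x_i t x_i^{-1} t (for i = 1,…,g), μ_j t μ_j^{-1} t^{-1} (for j = 1,…,k), μ_j^{α_j} t^{β_j} (for j = 1,…,k), and x_1^2 ⋯ x_g^2 μ_1 ⋯ μ_k. Then the abelianization of π contains an element of order 2. (This is the group-theoretic form of Lemma 3.1 of the paper, using the standard presentation of the fundamental group of the Seifert fibered space (−g | α_1/β_1, …, α_k/β_k).) -/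
/-- The generating set `x_1,…,x_g, μ_1,…,μ_k, t`. -/
abbrev PGen (g k : ℕ) : Type := Fin g ⊕ Fin k ⊕ Unit

/-- The generator `x_i` of the free group. -/
def PX (g k : ℕ) (i : Fin g) : FreeGroup (PGen g k) := FreeGroup.of (Sum.inl i)

/-- The generator `μ_j` of the free group. -/
def PM (g k : ℕ) (j : Fin k) : FreeGroup (PGen g k) := FreeGroup.of (Sum.inr (Sum.inl j))

/-- The generator `t` of the free group. -/
def PT (g k : ℕ) : FreeGroup (PGen g k) := FreeGroup.of (Sum.inr (Sum.inr ()))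

/-- The relators `x_i t x_i⁻¹ t`, `μ_j t μ_j⁻¹ t⁻¹`, `μ_j^{α_j} t^{β_j}`,
and `x_1² ⋯ x_g² μ_1 ⋯ μ_k`. -/
def PRels (g k : ℕ) (α β : Fin k → ℤ) : Set (FreeGroup (PGen g k)) :=
  (Set.range fun i : Fin g => PX g k i * PT g k * (PX g k i)⁻¹ * PT g k) ∪
  (Set.range fun j : Fin k => PM g k j * PT g k * (PM g k j)⁻¹ * (PT g k)⁻¹) ∪
  (Set.range fun j : Fin k => PM g k j ^ (α j) * PT g k ^ (β j)) ∪
  {((List.ofFn fun i : Fin g => (PX g k i) ^ 2) ++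
    (List.ofFn fun j : Fin k => PM g k j)).prod}

/-- The fundamental group of the Seifert fibered space
`(−g | α_1/β_1, …, α_k/β_k)` over a nonorientable base. -/
abbrev PGrp (g k : ℕ) (α β : Fin k → ℤ) : Type := PresentedGroup (PRels g k α β)

namespace PGrp

variable {g k : ℕ} {α β : Fin k → ℤ}

/-- The image of a word in the abelianization of `PGrp g k α β`. -/
def abMk (g k : ℕ) (α β : Fin k → ℤ) :
    FreeGroup (PGen g k) →* Abelianization (PGrp g k α β) :=
  Abelianization.of.comp (PresentedGroup.mk (PRels g k α β))

theorem abMk_eq_one {r : FreeGroup (PGen g k)} (hr : r ∈ PRels g k α β) :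
    abMk g k α β r = 1 := by
  have h : PresentedGroup.mk (PRels g k α β) r = 1 := PresentedGroup.one_of_mem hr
  simp [abMk, h]

theorem abMk_PT_sq (i : Fin g) : abMk g k α β (PT g k) ^ 2 = 1 := by
  have h : abMk g k α β (PX g k i * PT g k * (PX g k i)⁻¹ * PT g k) = 1 :=
    abMk_eq_one (Or.inl (Or.inl (Or.inl ⟨i, rfl⟩)))
  simpa [map_mul, map_inv, mul_right_comm, pow_two] using h

theorem abMk_PM_zpow (j : Fin k) :
    abMk g k α β (PM g k j) ^ α j * abMk g k α β (PT g k) ^ β j = 1 := by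
  have h : abMk g k α β (PM g k j ^ α j * PT g k ^ β j) = 1 :=
    abMk_eq_one (Or.inl (Or.inr ⟨j, rfl⟩))
  simpa [map_mul, map_zpow] using h

theorem prod_abMk_PX_sq_mul_prod_abMk_PM :
    (∏ i, abMk g k α β (PX g k i)) ^ 2 * ∏ j, abMk g k α β (PM g k j) = 1 := by
  have h := abMk_eq_one (α := α) (β := β) (Or.inr (Set.mem_singleton
    ((List.ofFn fun i : Fin g => (PX g k i) ^ 2) ++ (List.ofFn fun j : Fin k => PM g k j)).prod))
  rw [List.prod_append, map_mul, map_list_prod, map_list_prod, List.map_ofFn, List.map_ofFn,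
    List.prod_ofFn, List.prod_ofFn] at h
  simpa [Function.comp_def, Finset.prod_pow] using h

/-- Elements `s` and `u j` of a commutative group with `u j ^ α j = 1` and `s ^ 2 * ∏ j, u j = 1`
are the images of `∏ i, x_i` and `μ_j` under a homomorphism that kills `t`. -/
theorem exists_hom {C : Type*} [CommGroup C] (i₀ : Fin g) (s : C) (u : Fin k → C)
    (hu : ∀ j, u j ^ α j = 1) (hs : s ^ 2 * ∏ j, u j = 1) :
    ∃ φ : Abelianization (PGrp g k α β) →* C,
      φ (∏ i, abMk g k α β (PX g k i)) = s ∧ ∀ j, φ (abMk g k α β (PM g k j)) = u j := by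
  let v : PGen g k → C := Sum.elim (Pi.mulSingle i₀ s) (Sum.elim u fun _ => 1)
  have hX (i) : FreeGroup.lift v (PX g k i) = Pi.mulSingle (M := fun _ => C) i₀ s i := by
    simp [PX, v]
  have hM (j) : FreeGroup.lift v (PM g k j) = u j := by simp [PM, v]
  have hT : FreeGroup.lift v (PT g k) = 1 := by simp [PT, v]
  have hv : ∀ r ∈ PRels g k α β, FreeGroup.lift v r = 1 := by
    rintro r (((⟨i, rfl⟩ | ⟨j, rfl⟩) | ⟨j, rfl⟩) | rfl)
    · simp [hT]
    · simp [hT]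
    · simp [hT, hM, hu]
    · rw [List.prod_append, map_mul, map_list_prod, map_list_prod, List.map_ofFn, List.map_ofFn,
        List.prod_ofFn, List.prod_ofFn]
      simpa [Function.comp_def, hX, hM, Finset.prod_pow] using hs
  have hφ (w) : Abelianization.lift (PresentedGroup.toGroup hv) (abMk g k α β w) =
      FreeGroup.lift v w := rfl
  refine ⟨Abelianization.lift (PresentedGroup.toGroup hv), ?_, fun j => (hφ _).trans (hM j)⟩
  simp [map_prod, hφ, hX]

theorem exists_order_two_of_even (i₀ : Fin g) (ht : abMk g k α β (PT g k) = 1) {j : Fin k}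
    (hj : α j ≠ 0) (he : Even (α j)) :
    ∃ a : Abelianization (PGrp g k α β), a ≠ 1 ∧ a ^ 2 = 1 := by
  obtain ⟨c, hc⟩ := he
  have hn (z : ℤ) : (z : ZMod (2 * α j).natAbs) = 0 ↔ 2 * α j ∣ z := by
    rw [ZMod.intCast_zmod_eq_zero_iff_dvd, Int.natAbs_dvd]
  obtain ⟨φ, -, hφ⟩ := exists_hom (α := α) (β := β)
    (C := Multiplicative (ZMod (2 * α j).natAbs)) i₀
    (Multiplicative.ofAdd ((-1 : ℤ) : ZMod (2 * α j).natAbs))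
    (Pi.mulSingle j (Multiplicative.ofAdd ((2 : ℤ) : ZMod (2 * α j).natAbs)))
    (fun i => by
      rcases eq_or_ne i j with rfl | hij
      · rw [Pi.mulSingle_eq_same, ← ofAdd_zsmul, ofAdd_eq_one, zsmul_eq_mul, ← Int.cast_mul, hn,
          mul_comm]
      · simp [hij])
    (by
      rw [Finset.prod_pi_mulSingle', if_pos (Finset.mem_univ j), ← ofAdd_nsmul, ← ofAdd_add,
        ofAdd_eq_one]
      norm_num)
  refine ⟨abMk g k α β (PM g k j) ^ c, fun h => ?_, ?_⟩
  · have h' := congrArg φ h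
    rw [map_zpow, hφ, Pi.mulSingle_eq_same, map_one, ← ofAdd_zsmul, ofAdd_eq_one, zsmul_eq_mul,
      ← Int.cast_mul, hn] at h'
    obtain ⟨d, hd⟩ := h'
    have hc0 : c ≠ 0 := by omega
    have : c * (2 * (1 - 2 * d)) = 0 := by rw [hc] at hd; linarith
    rcases mul_eq_zero.1 this with h | h <;> omega
  · have h := abMk_PM_zpow (g := g) (α := α) (β := β) j
    rwa [ht, one_zpow, mul_one, hc, ← mul_two, zpow_mul, zpow_ofNat] at h

theorem exists_order_two_of_odd (i₀ : Fin g) (ht : abMk g k α β (PT g k) = 1)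
    (ho : ∀ j, Odd (α j)) :
    ∃ a : Abelianization (PGrp g k α β), a ≠ 1 ∧ a ^ 2 = 1 := by
  obtain ⟨φ, hφ, -⟩ := exists_hom (α := α) (β := β) (C := Multiplicative (ZMod 2)) i₀
    (Multiplicative.ofAdd 1) 1 (fun j => by simp) (by simp; decide)
  have hN : Odd (∏ j, α j) := Finset.prod_induction _ Odd (fun _ _ => Odd.mul) odd_one
    fun j _ => ho j
  refine ⟨(∏ i, abMk g k α β (PX g k i)) ^ (∏ j, α j), fun h => ?_, ?_⟩
  · have h' := congrArg φ h
    rw [map_zpow, hφ, φ.map_one, ← ofAdd_zsmul, ofAdd_eq_one, zsmul_one,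
      ZMod.intCast_zmod_eq_zero_iff_dvd] at h'
    exact Int.not_even_iff_odd.2 hN (even_iff_two_dvd.2 (by exact_mod_cast h'))
  · have hM : (∏ j, abMk g k α β (PM g k j)) ^ (∏ j, α j) = 1 := by
      rw [← Finset.prod_zpow]
      refine Finset.prod_eq_one fun j _ => ?_
      obtain ⟨d, hd⟩ := Finset.dvd_prod_of_mem α (Finset.mem_univ j)
      have h := abMk_PM_zpow (g := g) (α := α) (β := β) j
      rw [ht, one_zpow, mul_one] at h
      rw [hd, zpow_mul, h, one_zpow]
    have h := congrArg (· ^ (∏ j, α j))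
      (prod_abMk_PX_sq_mul_prod_abMk_PM (g := g) (α := α) (β := β))
    simp only [mul_zpow, hM, mul_one, one_zpow] at h
    rwa [← zpow_natCast, zpow_comm, zpow_natCast]

end PGrp

/-- Lemma 3.1 in group-theoretic form: the abelianization of the fundamental
group of a Seifert fibered space over a nonorientable base contains an element
of order 2. -/
theorem abelianization_has_order_two (g k : ℕ) (hg : 1 ≤ g) (α β : Fin k → ℤ)
    (hα : ∀ j, α j ≠ 0) (hβ : ∀ j, β j ≠ 0) :
    ∃ a : Abelianization (PGrp g k α β), a ≠ 1 ∧ a ^ 2 = 1 := by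
  let i₀ : Fin g := ⟨0, hg⟩
  by_cases ht : PGrp.abMk g k α β (PT g k) = 1
  · by_cases ho : ∀ j, Odd (α j)
    · exact PGrp.exists_order_two_of_odd i₀ ht ho
    · obtain ⟨j, hj⟩ := not_forall.1 ho
      exact PGrp.exists_order_two_of_even i₀ ht (hα j) (Int.not_odd_iff_even.1 hj)
  · exact ⟨_, ht, PGrp.abMk_PT_sq i₀⟩
end

section
/- Let g, k ∈ ℕ and let α_1,…,α_k and β_1,…,β_k be nonzero integers. If the image of t in the abelian group A(g,k,α,β) has finite additive order, then dim_ℚ (A(g,k,α,β) ⊗_ℤ ℚ) = 2g. (This is the finite-order case of Lemma 3.2 of the paper: if the class of a regular fiber γ is of finite order in H_1(M), then the first Betti number of M = (+g | α_1/β_1, …, α_k/β_k) equals 2g.) -/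
open TensorProduct

/-- The free abelian group on generators `x_1,…,x_g, y_1,…,y_g, μ_1,…,μ_k, t`. -/
abbrev AFree (g k : ℕ) : Type := (Fin g ⊕ Fin g ⊕ Fin k ⊕ Unit) →₀ ℤ

/-- The generator `x_i`. -/
noncomputable def Ax (g k : ℕ) (i : Fin g) : AFree g k := Finsupp.single (Sum.inl i) 1

/-- The generator `y_i`. -/
noncomputable def Ay (g k : ℕ) (i : Fin g) : AFree g k :=
  Finsupp.single (Sum.inr (Sum.inl i)) 1

/-- The generator `μ_j`. -/
noncomputable def Amu (g k : ℕ) (j : Fin k) : AFree g k :=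
  Finsupp.single (Sum.inr (Sum.inr (Sum.inl j))) 1

/-- The generator `t`. -/
noncomputable def At (g k : ℕ) : AFree g k :=
  Finsupp.single (Sum.inr (Sum.inr (Sum.inr ()))) 1

/-- The subgroup generated by the relations `α_j μ_j + β_j t` and `μ_1 + ⋯ + μ_k`. -/
noncomputable def ARels (g k : ℕ) (α β : Fin k → ℤ) : AddSubgroup (AFree g k) :=
  AddSubgroup.closure
    ((Set.range fun j : Fin k => α j • Amu g k j + β j • At g k) ∪
      {∑ j : Fin k, Amu g k j})

/-- The abelian group `A(g,k,α,β)`, the first homology of the Seifert fibered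
space `(+g | α_1/β_1, …, α_k/β_k)` with orientable base of genus `g`. -/
abbrev AGroup (g k : ℕ) (α β : Fin k → ℤ) : Type := AFree g k ⧸ ARels g k α β

/-- The class of the regular fiber `t` in `A(g,k,α,β)`. -/
noncomputable def Atbar (g k : ℕ) (α β : Fin k → ℤ) : AGroup g k α β :=
  QuotientAddGroup.mk (At g k)

/-- The projection of `A(g,k,α,β)` onto the free part generated by the `x_i` and `y_i`. -/
noncomputable def AGroup.proj (g k : ℕ) (α β : Fin k → ℤ) :
    AGroup g k α β →+ ((Fin g ⊕ Fin g) →₀ ℤ) :=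
  QuotientAddGroup.lift (ARels g k α β)
    (Finsupp.liftAddHom fun s =>
      (zmultiplesHom _) (Sum.elim (fun i => Finsupp.single (Sum.inl i) 1)
        (Sum.elim (fun i => Finsupp.single (Sum.inr i) 1) 0) s))
    (by
      rw [ARels, AddSubgroup.closure_le]
      rintro _ (⟨j, rfl⟩ | rfl) <;> simp [Amu, At])

/-- The map from the free abelian group on the `x_i` and `y_i` to `A(g,k,α,β)`. -/
noncomputable def AGroup.incl (g k : ℕ) (α β : Fin k → ℤ) :
    ((Fin g ⊕ Fin g) →₀ ℤ) →+ AGroup g k α β :=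
  Finsupp.liftAddHom fun s =>
    (zmultiplesHom _) (QuotientAddGroup.mk (Sum.elim (Ax g k) (Ay g k) s))

/-- Elements of finite additive order die after tensoring with `ℚ`. -/
theorem IsOfFinAddOrder.tmul_rat_eq_zero {A : Type*} [AddCommGroup A] {a : A}
    (h : IsOfFinAddOrder a) (q : ℚ) : q ⊗ₜ[ℤ] a = 0 := by
  obtain ⟨n, hn, hna⟩ := isOfFinAddOrder_iff_nsmul_eq_zero.mp h
  have hq : q = (n : ℤ) • (q / n) := by
    have : (n : ℚ) ≠ 0 := by exact_mod_cast hn.ne'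
    simp [field]
  rw [hq, TensorProduct.smul_tmul, natCast_zsmul, hna, TensorProduct.tmul_zero]

/-- If the fiber class has finite order, so does the class of each `μ_j`. -/
theorem isOfFinAddOrder_mk_Amu {g k : ℕ} {α β : Fin k → ℤ} (hα : ∀ j, α j ≠ 0)
    (h : IsOfFinAddOrder (Atbar g k α β)) (j : Fin k) :
    IsOfFinAddOrder (QuotientAddGroup.mk (Amu g k j) : AGroup g k α β) := by
  have hrel : α j • (QuotientAddGroup.mk (Amu g k j) : AGroup g k α β) +
      β j • Atbar g k α β = 0 :=
    (QuotientAddGroup.eq_zero_iff _).mpr (AddSubgroup.subset_closure (Or.inl ⟨j, rfl⟩))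
  have hfin : IsOfFinAddOrder (α j • (QuotientAddGroup.mk (Amu g k j) : AGroup g k α β)) := by
    rw [eq_neg_of_add_eq_zero_left hrel]
    exact h.zsmul.neg
  obtain ⟨n, hn, hn0⟩ := isOfFinAddOrder_iff_zsmul_eq_zero.mp hfin
  exact isOfFinAddOrder_iff_zsmul_eq_zero.mpr
    ⟨n * α j, mul_ne_zero hn (hα j), by rw [mul_smul, hn0]⟩

/-- Rationally, the projection to the free part is undone by the inclusion. -/
theorem AGroup.one_tmul_incl_proj {g k : ℕ} {α β : Fin k → ℤ} (hα : ∀ j, α j ≠ 0)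
    (h : IsOfFinAddOrder (Atbar g k α β)) (a : AGroup g k α β) :
    (1 : ℚ) ⊗ₜ[ℤ] AGroup.incl g k α β (AGroup.proj g k α β a) = 1 ⊗ₜ[ℤ] a := by
  let T : AGroup g k α β →+ ℚ ⊗[ℤ] AGroup g k α β :=
    (TensorProduct.mk ℤ ℚ (AGroup g k α β) 1).toAddMonoidHom
  suffices hT : T.comp ((AGroup.incl g k α β).comp (AGroup.proj g k α β)) = T from
    DFunLike.congr_fun hT a
  refine QuotientAddGroup.addMonoidHom_ext _ (Finsupp.addHom_ext' fun s => ?_)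
  ext
  rcases s with i | i | j | ⟨⟩
  · simp [T, AGroup.proj, AGroup.incl, Ax]
  · simp [T, AGroup.proj, AGroup.incl, Ay]
  · simpa [T, AGroup.proj, Amu] using
      ((isOfFinAddOrder_mk_Amu hα h j).tmul_rat_eq_zero 1).symm
  · simpa [T, AGroup.proj, Atbar, At] using (h.tmul_rat_eq_zero 1).symm

/-- If the fiber class has finite order, the free part computes `A(g,k,α,β)` rationally. -/
noncomputable def AGroup.ratEquiv {g k : ℕ} {α β : Fin k → ℤ} (hα : ∀ j, α j ≠ 0)
    (h : IsOfFinAddOrder (Atbar g k α β)) :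
    (ℚ ⊗[ℤ] AGroup g k α β) ≃ₗ[ℚ] (ℚ ⊗[ℤ] ((Fin g ⊕ Fin g) →₀ ℤ)) :=
  LinearEquiv.ofLinearMap ((AGroup.proj g k α β).toIntLinearMap.baseChange ℚ)
    ((AGroup.incl g k α β).toIntLinearMap.baseChange ℚ)
    (by
      rw [← LinearMap.baseChange_comp, ← LinearMap.baseChange_id]
      congr 1
      ext (i | i) : 2 <;> simp [AGroup.proj, AGroup.incl, Ax, Ay])
    (by
      rw [← LinearMap.baseChange_comp]
      refine TensorProduct.AlgebraTensorModule.curry_injective (LinearMap.ext_ring ?_)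
      ext a
      exact AGroup.one_tmul_incl_proj hα h a)

/-- Lemma 3.2, finite-order case: if the class of a regular fiber has finite
order in `H_1(M;ℤ)`, then the first Betti number of `M` is `2g`. -/
theorem betti_eq_of_fiber_finite_order (g k : ℕ) (α β : Fin k → ℤ)
    (hα : ∀ j, α j ≠ 0) (hβ : ∀ j, β j ≠ 0)
    (h : IsOfFinAddOrder (Atbar g k α β)) :
    Module.finrank ℚ (ℚ ⊗[ℤ] AGroup g k α β) = 2 * g := by
  rw [(AGroup.ratEquiv hα h).finrank_eq, Module.finrank_baseChange, Module.finrank_finsupp_self]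
  simp [two_mul]
end

section
/- Let g, k ∈ ℕ and let α_1,…,α_k and β_1,…,β_k be nonzero integers. If the image of t in the abelian group A(g,k,α,β) has infinite additive order, then dim_ℚ (A(g,k,α,β) ⊗_ℤ ℚ) = 2g + 1. (This is the infinite-order case of Lemma 3.2 of the paper: if the class of a regular fiber γ is of infinite order in H_1(M), then the first Betti number of M = (+g | α_1/β_1, …, α_k/β_k) equals 2g + 1.) -/
open TensorProduct

/-- If `t` has infinite order and `α_j m_j + β_j t = 0`, `∑ m_j = 0`, then `∑ β_j / α_j = 0`. -/
theorem sum_div_eq_zero_of_relations {B : Type*} [AddCommGroup B] {k : ℕ} (α β : Fin k → ℤ)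
    (hα : ∀ j, α j ≠ 0) (m : Fin k → B) (t : B) (hrel : ∀ j, α j • m j + β j • t = 0)
    (hm : ∑ j, m j = 0) (ht : ¬ IsOfFinAddOrder t) :
    ∑ j, (β j : ℚ) / α j = 0 := by
  have hzero : (∑ j, (∏ i ∈ Finset.univ.erase j, α i) * β j) • t = 0 := by
    have hj (j : Fin k) : ((∏ i ∈ Finset.univ.erase j, α i) * β j) • t =
        -((∏ i, α i) • m j) := by
      rw [← Finset.prod_erase_mul _ _ (Finset.mem_univ j), mul_smul, mul_smul, ← smul_neg,
        eq_neg_of_add_eq_zero_right (hrel j)]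
    rw [Finset.sum_smul, Finset.sum_congr rfl fun j _ => hj j, Finset.sum_neg_distrib,
      ← Finset.smul_sum, hm, smul_zero, neg_zero]
  have hn : ∑ j, (∏ i ∈ Finset.univ.erase j, α i) * β j = 0 := by
    by_contra hn
    exact ht (isOfFinAddOrder_iff_zsmul_eq_zero.2 ⟨_, hn, hzero⟩)
  have hP : (∏ i, (α i : ℚ)) ≠ 0 :=
    Finset.prod_ne_zero_iff.2 fun i _ => Int.cast_ne_zero.2 (hα i)
  refine (mul_eq_zero.1 ?_).resolve_left hP
  have hn_cast : ∑ j, (∏ i ∈ Finset.univ.erase j, (α i : ℚ)) * β j = 0 := by exact_mod_cast hn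
  rw [Finset.mul_sum, ← hn_cast]
  refine Finset.sum_congr rfl fun j _ => ?_
  have hj : (α j : ℚ) ≠ 0 := Int.cast_ne_zero.2 (hα j)
  rw [← Finset.prod_erase_mul _ _ (Finset.mem_univ j)]
  field_simp

/-- A relation `a m + b t = 0` with `a ≠ 0` expresses `m` through `t` after tensoring with `ℚ`. -/
theorem neg_div_smul_one_tmul {B : Type*} [AddCommGroup B] {a b : ℤ} (ha : a ≠ 0) {m t : B}
    (h : a • m + b • t = 0) :
    (-((b : ℚ) / a)) • ((1 : ℚ) ⊗ₜ[ℤ] t) = 1 ⊗ₜ[ℤ] m := by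
  have ha_cast : (a : ℚ) ≠ 0 := Int.cast_ne_zero.2 ha
  have htmul := congrArg (fun x => (1 : ℚ) ⊗ₜ[ℤ] x) h
  simp only [TensorProduct.tmul_add, TensorProduct.tmul_smul, TensorProduct.tmul_zero,
    ← Int.cast_smul_eq_zsmul ℚ] at htmul
  rw [neg_smul, div_eq_inv_mul, mul_smul, ← smul_neg, ← eq_neg_of_add_eq_zero_left htmul,
    inv_smul_smul₀ ha_cast]

/-- The relation `α_j μ_j + β_j t = 0` in `A(g,k,α,β)`. -/
theorem smul_mk_Amu_add_smul_Atbar (g k : ℕ) (α β : Fin k → ℤ) (j : Fin k) :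
    α j • (QuotientAddGroup.mk (Amu g k j) : AGroup g k α β) + β j • Atbar g k α β = 0 :=
  (QuotientAddGroup.eq_zero_iff (N := ARels g k α β) (α j • Amu g k j + β j • At g k)).2
    (AddSubgroup.subset_closure (Or.inl ⟨j, rfl⟩))

/-- The relation `μ_1 + ⋯ + μ_k = 0` in `A(g,k,α,β)`. -/
theorem sum_mk_Amu (g k : ℕ) (α β : Fin k → ℤ) :
    ∑ j, (QuotientAddGroup.mk (Amu g k j) : AGroup g k α β) = 0 := by
  have h : ((∑ j, Amu g k j : AFree g k) : AGroup g k α β) = 0 :=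
    (QuotientAddGroup.eq_zero_iff (N := ARels g k α β) _).2
      (AddSubgroup.subset_closure (Or.inr rfl))
  rw [← h]
  exact (map_sum (QuotientAddGroup.mk' (ARels g k α β)) _ _).symm

/-- The homomorphism from the free group on the generators to the rational vector space on
`x_i`, `y_i`, `t` sending `μ_j` to `-(β_j / α_j) t`. -/
noncomputable def freeToRat (g k : ℕ) (α β : Fin k → ℤ) :
    AFree g k →ₗ[ℤ] ((Fin g ⊕ Fin g ⊕ Unit) →₀ ℚ) :=
  Finsupp.linearCombination ℤ (Sum.elim (fun i => Finsupp.single (Sum.inl i) 1)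
    (Sum.elim (fun i => Finsupp.single (Sum.inr (Sum.inl i)) 1)
      (Sum.elim (fun j => Finsupp.single (Sum.inr (Sum.inr ())) (-((β j : ℚ) / α j)))
        (fun _ => Finsupp.single (Sum.inr (Sum.inr ())) 1))))

theorem ARels_le_ker_freeToRat (g k : ℕ) (α β : Fin k → ℤ) (hα : ∀ j, α j ≠ 0)
    (hsum : ∑ j, (β j : ℚ) / α j = 0) :
    ARels g k α β ≤ (freeToRat g k α β).toAddMonoidHom.ker := by
  refine (AddSubgroup.closure_le _).2 ?_
  rintro _ (⟨j, rfl⟩ | rfl)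
  · have hj : (α j : ℚ) ≠ 0 := Int.cast_ne_zero.2 (hα j)
    change freeToRat g k α β _ = 0
    simp only [freeToRat, Amu, At, map_add, Finsupp.linearCombination_single,
      Sum.elim_inr, Sum.elim_inl, Finsupp.smul_single, ← Finsupp.single_add]
    rw [Finsupp.single_eq_zero]
    simp only [smul_eq_mul, mul_one, zsmul_eq_mul]
    field_simp
    ring
  · change freeToRat g k α β _ = 0
    simp only [freeToRat, Amu, map_sum, Finsupp.linearCombination_single,
      Sum.elim_inr, Sum.elim_inl, one_smul, ← Finsupp.single_finsetSum]
    rw [Finset.sum_neg_distrib, hsum, neg_zero, Finsupp.single_zero]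

/-- If `∑ β_j / α_j = 0`, then `ℚ ⊗ A(g,k,α,β)` has basis `x_i`, `y_i`, `t`. -/
noncomputable def ratTensorEquiv (g k : ℕ) (α β : Fin k → ℤ) (hα : ∀ j, α j ≠ 0)
    (hsum : ∑ j, (β j : ℚ) / α j = 0) :
    (ℚ ⊗[ℤ] AGroup g k α β) ≃ₗ[ℚ] ((Fin g ⊕ Fin g ⊕ Unit) →₀ ℚ) :=
  let φ : AGroup g k α β →ₗ[ℤ] ((Fin g ⊕ Fin g ⊕ Unit) →₀ ℚ) :=
    (QuotientAddGroup.lift (ARels g k α β) (freeToRat g k α β).toAddMonoidHom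
      (ARels_le_ker_freeToRat g k α β hα hsum)).toIntLinearMap
  let ψ : ((Fin g ⊕ Fin g ⊕ Unit) →₀ ℚ) →ₗ[ℚ] (ℚ ⊗[ℤ] AGroup g k α β) :=
    Finsupp.linearCombination ℚ (Sum.elim (fun i => 1 ⊗ₜ QuotientAddGroup.mk (Ax g k i))
      (Sum.elim (fun i => 1 ⊗ₜ QuotientAddGroup.mk (Ay g k i)) (fun _ => 1 ⊗ₜ Atbar g k α β)))
  have hφ (v : AFree g k) : φ (QuotientAddGroup.mk v) = freeToRat g k α β v := rfl
  LinearEquiv.ofLinearMap (TensorProduct.AlgebraTensorModule.lift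
      (LinearMap.toSpanSingleton ℚ (AGroup g k α β →ₗ[ℤ] ((Fin g ⊕ Fin g ⊕ Unit) →₀ ℚ)) φ))
    ψ
    (by
      ext i : 2
      rcases i with i | i | i <;>
        simp [ψ, hφ, Atbar, Ax, Ay, At, freeToRat])
    (by
      refine TensorProduct.AlgebraTensorModule.curry_injective ?_
      refine LinearMap.ext_ring (LinearMap.toAddMonoidHom_injective ?_)
      refine QuotientAddGroup.addMonoidHom_ext _ (Finsupp.addHom_ext' fun i => ?_)
      refine AddMonoidHom.ext_int ?_
      rcases i with i | i | j | i
      · simp [ψ, hφ, Ax, freeToRat]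
      · simp [ψ, hφ, Ay, freeToRat]
      · simpa [ψ, hφ, Amu, freeToRat] using
          neg_div_smul_one_tmul (hα j) (smul_mk_Amu_add_smul_Atbar g k α β j)
      · simp [ψ, hφ, Atbar, At, freeToRat])

/-- Lemma 3.2, infinite-order case: if the class of a regular fiber has
infinite order in `H_1(M;ℤ)`, then the first Betti number of `M` is `2g + 1`. -/
theorem betti_eq_of_fiber_infinite_order (g k : ℕ) (α β : Fin k → ℤ)
    (hα : ∀ j, α j ≠ 0) (hβ : ∀ j, β j ≠ 0)
    (h : ¬ IsOfFinAddOrder (Atbar g k α β)) :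
    Module.finrank ℚ (ℚ ⊗[ℤ] AGroup g k α β) = 2 * g + 1 := by
  have hsum := sum_div_eq_zero_of_relations α β hα _ _
    (smul_mk_Amu_add_smul_Atbar g k α β) (sum_mk_Amu g k α β) h
  rw [(ratTensorEquiv g k α β hα hsum).finrank_eq, Module.finrank_finsupp_self]
  simp only [Fintype.card_sum, Fintype.card_fin, Fintype.card_unit]
  ring
end

section
/- Let g, k ∈ ℕ and let α_1,…,α_k and β_1,…,β_k be integers. Then in the abelian group A(g,k,α,β), one has (Σ_{j=1}^{k} (Π_{i≠j} α_i)·β_j) · t = 0, where the image of t is the class of the generator t. (This is the intermediate claim in the proof of Theorem 1.1 of the paper: the product of the multiplicities times the generalized Euler number of the Seifert fibration annihilates the class of the regular fiber in H_1.) -/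
open TensorProduct

/-- Intermediate claim in the proof of Theorem 1.1: the integer
`Σ_j (Π_{i≠j} α_i)·β_j` annihilates the class of the regular fiber in `H_1`. -/
theorem euler_number_annihilates_fiber (g k : ℕ) (α β : Fin k → ℤ) :
    (∑ j : Fin k, (∏ i ∈ Finset.univ.erase j, α i) * β j) • Atbar g k α β = 0 := by
  have hmem : (∑ j : Fin k, (∏ i ∈ Finset.univ.erase j, α i) * β j) • At g k ∈
      ARels g k α β := by
    have key : (∑ j : Fin k, (∏ i ∈ Finset.univ.erase j, α i) * β j) • At g k =
        ∑ j : Fin k, (∏ i ∈ Finset.univ.erase j, α i) • (α j • Amu g k j + β j • At g k) -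
          (∏ i, α i) • ∑ j : Fin k, Amu g k j := by
      rw [Finset.sum_smul, Finset.smul_sum, ← Finset.sum_sub_distrib]
      refine Finset.sum_congr rfl fun j _ => ?_
      rw [smul_add, smul_smul, smul_smul, Finset.prod_erase_mul _ _ (Finset.mem_univ j),
        add_sub_cancel_left]
    rw [key]
    refine sub_mem (sum_mem fun j _ => zsmul_mem ?_ _) (zsmul_mem ?_ _)
    · exact AddSubgroup.subset_closure (Or.inl ⟨j, rfl⟩)
    · exact AddSubgroup.subset_closure (Or.inr rfl)
  exact (QuotientAddGroup.eq_zero_iff _).mpr hmem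
end

section
/- Let g, k ∈ ℕ and let α_1,…,α_k and β_1,…,β_k be integers with each α_j ≠ 0. Then the image of t in the abelian group A(g,k,α,β) has infinite additive order if and only if Σ_{j=1}^{k} (Π_{i≠j} α_i)·β_j = 0. (This combines both directions used in the paper's proofs of Lemma 3.2 and Theorem 1.1: the class of a regular fiber has infinite order in H_1(M;ℤ) exactly when the generalized Euler number of the Seifert fibration vanishes.) -/
open TensorProduct

/-- The product of all `α_i` splits off its `j`-th factor. -/
theorem prod_erase_mul_self {k : ℕ} (α : Fin k → ℤ) (j : Fin k) :
    (∏ i ∈ Finset.univ.erase j, α i) * α j = ∏ i, α i :=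
  Finset.prod_erase_mul _ _ (Finset.mem_univ j)

theorem fiber_relation_mem_ARels (g k : ℕ) (α β : Fin k → ℤ) (j : Fin k) :
    α j • Amu g k j + β j • At g k ∈ ARels g k α β := by
  unfold ARels
  exact AddSubgroup.mem_closure_of_mem (Set.mem_union_left _ ⟨j, rfl⟩)

theorem sum_Amu_mem_ARels (g k : ℕ) (α β : Fin k → ℤ) :
    ∑ j : Fin k, Amu g k j ∈ ARels g k α β := by
  unfold ARels
  exact AddSubgroup.mem_closure_of_mem (Set.mem_union_right _ rfl)

/-- The Euler number times the fiber is a combination of the relations. -/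
theorem euler_number_zsmul_At_mem_ARels (g k : ℕ) (α β : Fin k → ℤ) :
    (∑ j : Fin k, (∏ i ∈ Finset.univ.erase j, α i) * β j) • At g k ∈ ARels g k α β := by
  have hfiber : ∑ j : Fin k, (∏ i ∈ Finset.univ.erase j, α i) •
      (α j • Amu g k j + β j • At g k) ∈ ARels g k α β :=
    sum_mem fun j _ => zsmul_mem (fiber_relation_mem_ARels g k α β j) _
  have hsection : (∏ i, α i) • ∑ j : Fin k, Amu g k j ∈ ARels g k α β :=
    zsmul_mem (sum_Amu_mem_ARels g k α β) _
  convert sub_mem hfiber hsection using 1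
  simp only [smul_add, smul_smul, prod_erase_mul_self, Finset.sum_add_distrib, Finset.smul_sum,
    Finset.sum_smul, add_sub_cancel_left]

/-- The homomorphism `t ↦ ∏ α_i`, `μ_j ↦ -(∏_{i ≠ j} α_i) β_j`, `x_i, y_i ↦ 0`. -/
noncomputable def fiberHom (g k : ℕ) (α β : Fin k → ℤ) : AFree g k →+ ℤ :=
  (Finsupp.linearCombination ℤ (Sum.elim 0 (Sum.elim 0 (Sum.elim
    (fun j => -((∏ i ∈ Finset.univ.erase j, α i) * β j)) fun _ => ∏ i, α i)))).toAddMonoidHom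

theorem fiberHom_At (g k : ℕ) (α β : Fin k → ℤ) : fiberHom g k α β (At g k) = ∏ i, α i := by
  simp [fiberHom, At]

theorem fiberHom_Amu (g k : ℕ) (α β : Fin k → ℤ) (j : Fin k) :
    fiberHom g k α β (Amu g k j) = -((∏ i ∈ Finset.univ.erase j, α i) * β j) := by
  simp [fiberHom, Amu]

/-- If the Euler number vanishes then `fiberHom` descends to `AGroup`. -/
theorem ARels_le_ker_fiberHom (g k : ℕ) (α β : Fin k → ℤ)
    (h : ∑ j : Fin k, (∏ i ∈ Finset.univ.erase j, α i) * β j = 0) :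
    ARels g k α β ≤ (fiberHom g k α β).ker := by
  refine (AddSubgroup.closure_le _).2 ?_
  rintro _ (⟨j, rfl⟩ | rfl)
  · simp only [SetLike.mem_coe, AddMonoidHom.mem_ker, map_add, map_zsmul, fiberHom_At,
      fiberHom_Amu, smul_eq_mul, ← prod_erase_mul_self α j]
    ring
  · simp only [SetLike.mem_coe, AddMonoidHom.mem_ker, map_sum, fiberHom_Amu,
      Finset.sum_neg_distrib, h, neg_zero]

/-- The class of a regular fiber has infinite order in `H_1(M;ℤ)` exactly when
the generalized Euler number of the Seifert fibration vanishes. -/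
theorem fiber_infinite_order_iff_euler_number_zero (g k : ℕ) (α β : Fin k → ℤ)
    (hα : ∀ j, α j ≠ 0) :
    ¬ IsOfFinAddOrder (Atbar g k α β) ↔
      ∑ j : Fin k, (∏ i ∈ Finset.univ.erase j, α i) * β j = 0 := by
  rw [isOfFinAddOrder_iff_zsmul_eq_zero]
  have hzsmul (n : ℤ) : n • Atbar g k α β = 0 ↔ n • At g k ∈ ARels g k α β :=
    QuotientAddGroup.eq_zero_iff (n • At g k)
  simp only [hzsmul]
  constructor
  · intro h
    by_contra hne
    exact h ⟨_, hne, euler_number_zsmul_At_mem_ARels g k α β⟩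
  · rintro h ⟨n, hn, hmem⟩
    have hker := ARels_le_ker_fiberHom g k α β h hmem
    rw [AddMonoidHom.mem_ker, map_zsmul, fiberHom_At, smul_eq_mul] at hker
    exact mul_ne_zero hn (Finset.prod_ne_zero_iff.2 fun j _ => hα j) hker
end

section
/- Let g ≥ 1 and k ≥ 0, let m be an odd integer, and let α_1,…,α_k be odd integers. In the free abelian group on generators x_1,…,x_g, μ_1,…,μ_k, the element m·(x_1 + ⋯ + x_g) does not lie in the subgroup generated by the element 2·(x_1 + ⋯ + x_g) + μ_1 + ⋯ + μ_k together with the elements α_j·μ_j (for j = 1,…,k). (This is the key step in the proof of Lemma 3.1 of the paper: m·Σx_i cannot be a ℤ-linear combination of the relations {2Σx_i + Σμ_j, α_j μ_j} since m is odd.) -/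
/-- The free abelian group on generators `x_1,…,x_g, μ_1,…,μ_k`. -/
abbrev BFree (g k : ℕ) : Type := (Fin g ⊕ Fin k) →₀ ℤ

/-- The generator `x_i`. -/
noncomputable def Bx (g k : ℕ) (i : Fin g) : BFree g k := Finsupp.single (Sum.inl i) 1

/-- The generator `μ_j`. -/
noncomputable def Bmu (g k : ℕ) (j : Fin k) : BFree g k := Finsupp.single (Sum.inr j) 1

theorem sum_Bx_apply_inl (g k : ℕ) (i : Fin g) : (∑ i' : Fin g, Bx g k i') (Sum.inl i) = 1 := by
  simp [Bx, Finsupp.finsetSum_apply, Finsupp.single_apply]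

theorem Bmu_apply_inl (g k : ℕ) (j : Fin k) (i : Fin g) : Bmu g k j (Sum.inl i) = 0 := by
  simp [Bmu]

/-- Key step in the proof of Lemma 3.1: for `m` odd, `m·Σx_i` is not a
ℤ-linear combination of the relations `2Σx_i + Σμ_j` and `α_j μ_j`. -/
theorem odd_multiple_not_in_relations (g k : ℕ) (hg : 1 ≤ g) (m : ℤ) (hm : Odd m)
    (α : Fin k → ℤ) (hα : ∀ j, Odd (α j)) :
    m • (∑ i : Fin g, Bx g k i) ∉
      AddSubgroup.closure
        ({(2 : ℤ) • (∑ i : Fin g, Bx g k i) + ∑ j : Fin k, Bmu g k j} ∪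
          Set.range fun j : Fin k => α j • Bmu g k j) := by
  intro h
  let i : Fin g := ⟨0, hg⟩
  let evenCoord : AddSubgroup (BFree g k) :=
    (AddSubgroup.zmultiples (2 : ℤ)).comap (Finsupp.applyAddHom (Sum.inl i))
  have hle : AddSubgroup.closure
      ({(2 : ℤ) • (∑ i : Fin g, Bx g k i) + ∑ j : Fin k, Bmu g k j} ∪
        Set.range fun j : Fin k => α j • Bmu g k j) ≤ evenCoord := by
    rw [AddSubgroup.closure_le]
    rintro _ (rfl | ⟨j, rfl⟩) <;>
      simp [evenCoord, Bmu_apply_inl, Int.mem_zmultiples_iff,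
        Finsupp.finsetSum_apply, -Finsupp.coe_finsetSum]
  have h2 : (2 : ℤ) ∣ m := by
    simpa [evenCoord, sum_Bx_apply_inl, Int.mem_zmultiples_iff, -Finsupp.coe_finsetSum]
      using hle h
  exact Int.not_even_iff_odd.mpr hm (even_iff_two_dvd.mpr h2)
end
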